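/- For every ε > 0 and every finite set Ω there exists N = N(ε,Ω) > 0 such that for every n > N, every probability measure μ on Ω^n, and every partition V₀ of [n] with at most 1/ε classes, there exist a partition V of [n] refining V₀ and a partition S of Ω^n with #V + #S ≤ N such that μ is ε-homogeneous with respect to (V, S). -/

import Mathlib

open Finset

noncomputable section

/-- `μ` is a probability mass function on the finite type `X`. -/
def IsPMF {X : Type*} [Fintype X] (μ : X → ℝ) : Prop :=
  (∀ x, 0 ≤ μ x) ∧ ∑ x, μ x = 1

/-- Total variation distance between two mass functions (half the `L¹` distance,
so that `‖ν − ν'‖_TV = max_A |ν(A) − ν'(A)|` for probability measures). -/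
def tv {X : Type*} [Fintype X] (p q : X → ℝ) : ℝ :=
  (∑ x, |p x - q x|) / 2

/-- Expectation `⟨f⟩_μ` of `f` under `μ`. -/
def expec {X : Type*} [Fintype X] (μ : X → ℝ) (f : X → ℝ) : ℝ :=
  ∑ x, μ x * f x

/-- Mass `μ(S)` of a finite set `S`. -/
def mass {X : Type*} (μ : X → ℝ) (S : Finset X) : ℝ :=
  ∑ x ∈ S, μ x

/-- The conditional measure `μ[·|S]`. -/
def condPMF {X : Type*} [DecidableEq X] (μ : X → ℝ) (S : Finset X) (x : X) : ℝ :=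
  if x ∈ S then μ x / mass μ S else 0

/-- The conditional expectation `⟨f | S⟩_μ`. -/
def condExpect {X : Type*} (μ : X → ℝ) (S : Finset X) (f : X → ℝ) : ℝ :=
  (∑ x ∈ S, μ x * f x) / mass μ S

/-- Empirical distribution `σ[·|S]` of the values of `σ` on `S`. -/
def empDist {V Ω : Type*} [DecidableEq Ω] (σ : V → Ω) (S : Finset V) (ω : Ω) : ℝ :=
  ((S.filter fun x => σ x = ω).card : ℝ) / (S.card : ℝ)

/-- The marginal law `μ_↓x` of the coordinate `x` under `μ ∈ P(Ω^n)`. -/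
def marg1 {Ω : Type*} [Fintype Ω] [DecidableEq Ω] {n : ℕ} (μ : (Fin n → Ω) → ℝ)
    (x : Fin n) (ω : Ω) : ℝ :=
  ∑ σ ∈ Finset.univ.filter (fun σ : Fin n → Ω => σ x = ω), μ σ

/-- The joint law `μ_↓(x₁,…,x_k)` of the coordinates `xs` under `μ ∈ P(Ω^n)`. -/
def margLaw {Ω : Type*} [Fintype Ω] [DecidableEq Ω] {n k : ℕ} (μ : (Fin n → Ω) → ℝ)
    (xs : Fin k → Fin n) (τ : Fin k → Ω) : ℝ :=
  ∑ σ ∈ Finset.univ.filter (fun σ : Fin n → Ω => ∀ i, σ (xs i) = τ i), μ σ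

/-- The joint law `μ_↓(x,y)` of a pair of coordinates under `μ ∈ P(Ω^n)`. -/
def pairLaw {Ω : Type*} [Fintype Ω] [DecidableEq Ω] {n : ℕ} (μ : (Fin n → Ω) → ℝ)
    (x y : Fin n) (τ : Ω × Ω) : ℝ :=
  ∑ σ ∈ Finset.univ.filter (fun σ : Fin n → Ω => σ x = τ.1 ∧ σ y = τ.2), μ σ

/-- `(1/n^k) Σ_{x₁,…,x_k} ‖μ_↓(x₁,…,x_k) − μ_↓x₁ ⊗ ⋯ ⊗ μ_↓x_k‖_TV`. -/
def stateSum {Ω : Type*} [Fintype Ω] [DecidableEq Ω] {n : ℕ} (k : ℕ)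
    (μ : (Fin n → Ω) → ℝ) : ℝ :=
  (1 / (n : ℝ) ^ k) * ∑ xs : Fin k → Fin n,
    tv (margLaw μ xs) (fun τ : Fin k → Ω => ∏ i, marg1 μ (xs i) (τ i))

/-- `S` is an `(ε,k)`-state of `μ`. -/
def IsState {Ω : Type*} [Fintype Ω] [DecidableEq Ω] {n : ℕ} (ε : ℝ) (k : ℕ)
    (μ : (Fin n → Ω) → ℝ) (S : Finset (Fin n → Ω)) : Prop :=
  0 < mass μ S ∧ stateSum k (condPMF μ S) < ε

/-- `μ` is `(ε,k)`-symmetric. -/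
def IsSymmetric {Ω : Type*} [Fintype Ω] [DecidableEq Ω] {n : ℕ} (ε : ℝ) (k : ℕ)
    (μ : (Fin n → Ω) → ℝ) : Prop :=
  stateSum k μ < ε

/-- A partition of a type `X` into finitely many nonempty finite classes. -/
structure FinPartition (X : Type*) where
  k : ℕ
  part : Fin k → Finset X
  nonempty : ∀ i, (part i).Nonempty
  disj : ∀ i j, i ≠ j → Disjoint (part i) (part j)
  covers : ∀ x, ∃ i, x ∈ part i

/-- `W` refines `V`: every class of `W` is contained in a class of `V`. -/
def FinPartition.Refines {X : Type*} (W V : FinPartition X) : Prop :=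
  ∀ i, ∃ j, W.part i ⊆ V.part j

/-- `μ` is `ε`-regular on the set `U ⊆ [n]`. -/
def regularOn {Ω : Type*} [Fintype Ω] [DecidableEq Ω] {n : ℕ} (ε : ℝ)
    (μ : (Fin n → Ω) → ℝ) (U : Finset (Fin n)) : Prop :=
  ∀ S ⊆ U, ε * (U.card : ℝ) ≤ (S.card : ℝ) →
    expec μ (fun σ => tv (empDist σ S) (empDist σ U)) < ε

/-- `μ` is `ε`-regular with respect to a partition `V` of `[n]`. -/
def regularPart {Ω : Type*} [Fintype Ω] [DecidableEq Ω] {n : ℕ} (ε : ℝ)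
    (μ : (Fin n → Ω) → ℝ) (V : FinPartition (Fin n)) : Prop :=
  ∃ J : Finset (Fin V.k),
    (∑ i ∈ Finset.univ \ J, ((V.part i).card : ℝ)) < ε * n ∧
    ∀ i ∈ J, regularOn ε μ (V.part i)

/-- `μ` is `ε`-homogeneous with respect to `(V, S)`. -/
def homogeneous {Ω : Type*} [Fintype Ω] [DecidableEq Ω] {n : ℕ} (ε : ℝ)
    (μ : (Fin n → Ω) → ℝ) (V : FinPartition (Fin n)) (S : FinPartition (Fin n → Ω)) : Prop :=
  ∃ I : Finset (Fin S.k),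
    (∀ i ∈ I, 0 < mass μ (S.part i)) ∧
    (∑ i ∈ Finset.univ \ I, mass μ (S.part i)) < ε ∧
    (∀ i : Fin S.k, ∀ j : Fin V.k, ∀ σ ∈ S.part i, ∀ σ' ∈ S.part i,
       tv (empDist σ (V.part j)) (empDist σ' (V.part j)) < ε) ∧
    (∀ i ∈ I, regularPart ε (condPMF μ (S.part i)) V) ∧
    regularPart ε μ V

/-- The index `ind_μ(V)` of `μ` with respect to the partition `V`. -/
def muIndex {Ω : Type*} [Fintype Ω] [DecidableEq Ω] {n : ℕ}
    (μ : (Fin n → Ω) → ℝ) (V : FinPartition (Fin n)) : ℝ :=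
  (1 / ((Fintype.card Ω : ℝ) * n)) * ∑ ω : Ω, ∑ j : Fin V.k, ∑ x ∈ V.part j,
    expec μ (fun σ => ((if σ x = ω then (1 : ℝ) else 0) - empDist σ (V.part j) ω) ^ 2)

/-- The product measure `μ ⊗ μ`, regarded as a measure on `(Ω × Ω)^n`. -/
def tensorPMF {Ω : Type*} {n : ℕ} (μ : (Fin n → Ω) → ℝ) : (Fin n → Ω × Ω) → ℝ :=
  fun σ => μ (fun i => (σ i).1) * μ (fun i => (σ i).2)

/-- The `n`-fold product `p^{⊗n}` of `p ∈ P(Ω)`. -/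
def productPMF {Ω : Type*} [Fintype Ω] {n : ℕ} (p : Ω → ℝ) : (Fin n → Ω) → ℝ :=
  fun σ => ∏ i, p (σ i)

/-- Entropy `H(q)` of a mass function. -/
def entropy {X : Type*} [Fintype X] (q : X → ℝ) : ℝ :=
  -∑ x, q x * Real.log (q x)

/-- Kullback–Leibler divergence `KL(ν‖μ)`. -/
def klDiv {X : Type*} [Fintype X] (ν μ : X → ℝ) : ℝ :=
  ∑ x, ν x * Real.log (ν x / μ x)

/-- The `j`-th marginal `q_↓j` of `q ∈ P(Ω^d)`. -/
def margOf {Ω : Type*} [Fintype Ω] [DecidableEq Ω] {d : ℕ} (q : (Fin d → Ω) → ℝ)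
    (j : Fin d) (ω : Ω) : ℝ :=
  ∑ τ ∈ Finset.univ.filter (fun τ : Fin d → Ω => τ j = ω), q τ

/-- Average of `f` over `S`. -/
def avgH {X : Type*} (f : X → ℝ) (S : Finset X) : ℝ := (∑ x ∈ S, f x) / (S.card : ℝ)

lemma avgH_mul {X : Type*} (f : X → ℝ) (S : Finset X) :
    (S.card : ℝ) * avgH f S = ∑ x ∈ S, f x := by
  unfold avgH
  rcases S.eq_empty_or_nonempty with h | h
  · simp [h]
  · have : (S.card : ℝ) ≠ 0 := by exact_mod_cast h.card_pos.ne'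
    field_simp

lemma empDist_eq_avgH {V Ω : Type*} [DecidableEq Ω] (σ : V → Ω) (S : Finset V) (ω : Ω) :
    empDist σ S ω = avgH (fun x => if σ x = ω then (1 : ℝ) else 0) S := by
  unfold empDist avgH
  rw [Finset.sum_ite]
  simp

lemma empDist_nonneg {V Ω : Type*} [DecidableEq Ω] (σ : V → Ω) (S : Finset V) (ω : Ω) :
    0 ≤ empDist σ S ω := by
  unfold empDist; positivity

lemma empDist_le_one {V Ω : Type*} [DecidableEq Ω] (σ : V → Ω) (S : Finset V) (ω : Ω) :
    empDist σ S ω ≤ 1 := by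
  unfold empDist
  apply div_le_one_of_le₀
  · exact_mod_cast Finset.card_filter_le _ _
  · positivity

lemma orthH {X B : Type*} [Fintype X] [Fintype B] [DecidableEq B] (f h : X → ℝ) (c : X → B)
    (hh : ∀ x y, c x = c y → h x = h y) :
    ∑ x, (f x - avgH f (univ.filter fun y => c y = c x)) * h x = 0 := by
  rw [← Finset.sum_fiberwise univ c]
  apply Finset.sum_eq_zero
  intro b _
  rcases (univ.filter fun y => c y = b).eq_empty_or_nonempty with he | ⟨z, hz⟩
  · rw [he]; simp
  · have hz' : c z = b := by simpa using hz
    have : ∀ x ∈ univ.filter (fun y => c y = b),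
        (f x - avgH f (univ.filter fun y => c y = c x)) * h x
          = (f x - avgH f (univ.filter fun y => c y = b)) * h z := by
      intro x hx
      have hx' : c x = b := by simpa using hx
      rw [hx', hh x z (hx'.trans hz'.symm)]
    rw [Finset.sum_congr rfl this, ← Finset.sum_mul, Finset.sum_sub_distrib, Finset.sum_const,
      nsmul_eq_mul, avgH_mul, sub_self, zero_mul]

lemma energyH {X A B : Type*} [Fintype X] [DecidableEq X] [Fintype A] [DecidableEq A]
    [Fintype B] [DecidableEq B]
    (f : X → ℝ) (c : X → A) (c' : X → B) (W : Finset X)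
    (hc : ∀ x y, c' x = c' y → c x = c y) (hW : ∀ x y, c' x = c' y → (x ∈ W ↔ y ∈ W)) :
    ∑ x, (f x - avgH f (univ.filter fun y => c' y = c' x)) ^ 2
      + ∑ a, ((W ∩ univ.filter fun y => c y = a).card : ℝ) *
          (avgH f (W ∩ univ.filter fun y => c y = a) - avgH f (univ.filter fun y => c y = a)) ^ 2
      ≤ ∑ x, (f x - avgH f (univ.filter fun y => c y = c x)) ^ 2 := by
  set q : X → ℝ := fun x => avgH f (univ.filter fun y => c' y = c' x) with hq
  set p : X → ℝ := fun x => avgH f (univ.filter fun y => c y = c x) with hp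
  have hqp : ∀ x y, c' x = c' y → (q x - p x) = (q y - p y) := by
    intro x y h
    simp only [hq, hp]
    rw [h, hc x y h]
  have h1 : ∑ x, (f x - p x) ^ 2 = ∑ x, (f x - q x) ^ 2 + ∑ x, (q x - p x) ^ 2 := by
    have := orthH f (fun x => q x - p x) c' hqp
    have h2 : ∑ x, (f x - p x) ^ 2 = ∑ x, (f x - q x) ^ 2 + ∑ x, (q x - p x) ^ 2
        + 2 * ∑ x, (f x - q x) * (q x - p x) := by
      rw [Finset.mul_sum, ← Finset.sum_add_distrib, ← Finset.sum_add_distrib]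
      apply Finset.sum_congr rfl
      intro x _
      ring
    rw [h2, this]; ring
  change ∑ x, (f x - q x) ^ 2 + _ ≤ ∑ x, (f x - p x) ^ 2
  rw [h1]
  gcongr
  calc _ ≤ ∑ a, ∑ x ∈ W with c x = a, (q x - p x) ^ 2 := ?_
    _ = ∑ x ∈ W, (q x - p x) ^ 2 := Finset.sum_fiberwise _ _ _
    _ ≤ _ := Finset.sum_le_sum_of_subset_of_nonneg (Finset.subset_univ _) (fun _ _ _ => sq_nonneg _)
  apply Finset.sum_le_sum
  intro a _
  have hWa : (W ∩ univ.filter fun y => c y = a) = W.filter (fun y => c y = a) := by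
    ext; simp
  rw [hWa]
  set T := W.filter (fun y => c y = a) with hT
  set ea := avgH f (univ.filter fun y => c y = a) with hea
  have hsum : ∑ x ∈ T, (q x - p x) = T.card * (avgH f T - ea) := by
    have h3 := orthH f (fun x => if x ∈ T then 1 else 0) c' (by
      intro x y h
      have : x ∈ T ↔ y ∈ T := by
        simp only [hT, Finset.mem_filter, hW x y h, hc x y h]
      simp only [this])
    simp only [mul_ite, mul_one, mul_zero, Finset.sum_ite_mem, Finset.univ_inter,
      Finset.sum_sub_distrib] at h3
    have h4 : ∑ x ∈ T, p x = T.card * ea := by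
      rw [← nsmul_eq_mul, ← Finset.sum_const]
      apply Finset.sum_congr rfl
      intro x hx
      have : c x = a := (Finset.mem_filter.1 hx).2
      simp only [hp, this, hea]
    rw [Finset.sum_sub_distrib, h4, mul_sub, avgH_mul]
    linarith
  rcases T.eq_empty_or_nonempty with he | hne
  · simp [he]
  have hpos : (0 : ℝ) < T.card := by exact_mod_cast hne.card_pos
  have hcs := sq_sum_le_card_mul_sum_sq (s := T) (f := fun x => q x - p x)
  rw [hsum] at hcs
  have : (T.card : ℝ) * (T.card * (avgH f T - ea) ^ 2) ≤ T.card * ∑ x ∈ T, (q x - p x) ^ 2 := by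
    calc _ = (T.card * (avgH f T - ea)) ^ 2 := by ring
      _ ≤ _ := hcs
  exact le_of_mul_le_mul_left this hpos

/-- Index of the class containing `x`. -/
def FinPartition.idxH {X : Type*} (V : FinPartition X) (x : X) : Fin V.k := (V.covers x).choose

lemma FinPartition.mem_idxH {X : Type*} (V : FinPartition X) (x : X) : x ∈ V.part (V.idxH x) :=
  (V.covers x).choose_spec

lemma FinPartition.idxH_eq {X : Type*} (V : FinPartition X) (x : X) (i : Fin V.k) :
    V.idxH x = i ↔ x ∈ V.part i := by
  constructor
  · rintro rfl; exact V.mem_idxH x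
  · intro h
    by_contra hne
    exact (Finset.disjoint_left.1 (V.disj _ _ hne) (V.mem_idxH x)) h

lemma FinPartition.part_eq {X : Type*} [Fintype X] (V : FinPartition X) (i : Fin V.k) :
    V.part i = univ.filter (fun y => V.idxH y = i) := by
  ext y; simp [V.idxH_eq]

lemma exists_ofColoring {X A : Type*} [Fintype X] [Fintype A] (c : X → A) :
    ∃ P : FinPartition X, P.k ≤ Fintype.card A ∧ ∀ x y, P.idxH x = P.idxH y ↔ c x = c y := by
  classical
  let e := (univ.image c).equivFin
  let P : FinPartition X :=
    { k := (univ.image c).card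
      part := fun i => univ.filter (fun x => c x = (e.symm i : A))
      nonempty := by
        intro i
        obtain ⟨x, _, hx⟩ := Finset.mem_image.1 (e.symm i).2
        exact ⟨x, by simp [hx]⟩
      disj := by
        intro i j hij
        rw [Finset.disjoint_left]
        intro x hx hy
        simp only [Finset.mem_filter, Finset.mem_univ, true_and] at hx hy
        exact hij (e.symm.injective (Subtype.ext (hx.symm.trans hy)))
      covers := by
        intro x
        exact ⟨e ⟨c x, Finset.mem_image_of_mem _ (Finset.mem_univ _)⟩, by simp⟩ }
  refine ⟨P, Finset.card_le_univ _, ?_⟩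
  have key : ∀ x, c x = (e.symm (P.idxH x) : A) := by
    intro x
    have := P.mem_idxH x
    simpa [P] using this
  intro x y
  constructor
  · intro h; rw [key x, key y, h]
  · intro h
    apply e.symm.injective
    apply Subtype.ext
    rw [← key x, ← key y, h]

lemma refineH {n : ℕ} {β : Type*} [Fintype β] (V : FinPartition (Fin n))
    (W : β → Finset (Fin n)) :
    ∃ V' : FinPartition (Fin n), V'.k ≤ V.k * 2 ^ Fintype.card β ∧ V'.Refines V ∧
      ∀ x y, V'.idxH x = V'.idxH y → V.idxH x = V.idxH y ∧ ∀ b, (x ∈ W b ↔ y ∈ W b) := by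
  classical
  obtain ⟨P, hk, hP⟩ := exists_ofColoring
    (fun x => ((V.idxH x, fun b => decide (x ∈ W b)) : Fin V.k × (β → Bool)))
  have h2 : ∀ x y, P.idxH x = P.idxH y → V.idxH x = V.idxH y ∧ ∀ b, (x ∈ W b ↔ y ∈ W b) := by
    intro x y h
    have := (hP x y).1 h
    simp only [Prod.mk.injEq] at this
    refine ⟨this.1, fun b => ?_⟩
    have := congrFun this.2 b
    simpa using this
  refine ⟨P, by simpa using hk, ?_, h2⟩
  intro i
  obtain ⟨x, hx⟩ := P.nonempty i
  refine ⟨V.idxH x, fun y hy => ?_⟩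
  rw [← V.idxH_eq]
  exact (h2 y x (((P.idxH_eq y i).2 hy).trans ((P.idxH_eq x i).2 hx).symm)).1

section
variable {Ω : Type} [Fintype Ω] [DecidableEq Ω] {n : ℕ}

/-- Residual energy. -/
def resH (V : FinPartition (Fin n)) (σ : Fin n → Ω) : ℝ :=
  ∑ ω, ∑ x, ((if σ x = ω then (1 : ℝ) else 0) - empDist σ (V.part (V.idxH x)) ω) ^ 2

/-- Energy gain. -/
def gainH (V : FinPartition (Fin n)) (W : Finset (Fin n)) (σ : Fin n → Ω) : ℝ :=
  ∑ ω, ∑ j, ((W ∩ V.part j).card : ℝ) * (empDist σ (W ∩ V.part j) ω - empDist σ (V.part j) ω) ^ 2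

lemma gainH_nonneg (V : FinPartition (Fin n)) (W : Finset (Fin n)) (σ : Fin n → Ω) :
    0 ≤ gainH V W σ := by unfold gainH; positivity

lemma resH_nonneg (V : FinPartition (Fin n)) (σ : Fin n → Ω) :
    0 ≤ resH V σ := by unfold resH; positivity

lemma resH_le (V : FinPartition (Fin n)) (σ : Fin n → Ω) :
    resH V σ ≤ Fintype.card Ω * n := by
  unfold resH
  calc _ ≤ ∑ ω : Ω, ∑ x : Fin n, (1 : ℝ) := by
        apply Finset.sum_le_sum; intro ω _
        apply Finset.sum_le_sum; intro x _
        have h0 := empDist_nonneg σ (V.part (V.idxH x)) ω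
        have h1 := empDist_le_one σ (V.part (V.idxH x)) ω
        split_ifs <;> nlinarith
    _ = _ := by simp

lemma resH_gain (V V' : FinPartition (Fin n)) (W : Finset (Fin n)) (σ : Fin n → Ω)
    (h : ∀ x y, V'.idxH x = V'.idxH y → V.idxH x = V.idxH y ∧ (x ∈ W ↔ y ∈ W)) :
    resH V' σ + gainH V W σ ≤ resH V σ := by
  unfold resH gainH
  rw [← Finset.sum_add_distrib]
  apply Finset.sum_le_sum
  intro ω _
  simp only [empDist_eq_avgH, FinPartition.part_eq]
  exact energyH _ _ _ _ (fun x y hxy => (h x y hxy).1) (fun x y hxy => (h x y hxy).2)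

lemma tv_sq_le {Ω : Type} [Fintype Ω] (p q : Ω → ℝ) : tv p q ^ 2 ≤ Fintype.card Ω * ∑ ω, (p ω - q ω) ^ 2 := by
  have := sq_sum_le_card_mul_sum_sq (s := (univ : Finset Ω)) (f := fun x => |p x - q x|)
  simp only [sq_abs, Finset.card_univ] at this
  unfold tv
  nlinarith [sq_nonneg (∑ x, |p x - q x|)]

lemma witnessH (ε : ℝ) (hε : 0 < ε) (hΩ : 0 < Fintype.card Ω) (ν : (Fin n → Ω) → ℝ)
    (hν : IsPMF ν) (V : FinPartition (Fin n)) (hr : ¬ regularPart ε ν V) :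
    ∃ W : Finset (Fin n), ε ^ 4 * n / Fintype.card Ω ≤ ∑ σ, ν σ * gainH V W σ := by
  classical
  have hD : (0 : ℝ) < Fintype.card Ω := by exact_mod_cast hΩ
  set J : Finset (Fin V.k) := univ.filter (fun j => regularOn ε ν (V.part j)) with hJ
  have hbad : ε * n ≤ ∑ j ∈ univ \ J, ((V.part j).card : ℝ) := by
    by_contra hlt
    push Not at hlt
    exact hr ⟨J, hlt, fun i hi => by simpa [hJ] using hi⟩
  have hT : ∀ j : Fin V.k, ∃ T ⊆ V.part j, j ∉ J → ε * ((V.part j).card : ℝ) ≤ (T.card : ℝ) ∧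
      ε ≤ expec ν (fun σ => tv (empDist σ T) (empDist σ (V.part j))) := by
    intro j
    by_cases hj : j ∈ J
    · exact ⟨∅, by simp, fun h => absurd hj h⟩
    · have : ¬ regularOn ε ν (V.part j) := by simpa [hJ] using hj
      unfold regularOn at this
      push Not at this
      obtain ⟨T, h1, h2, h3⟩ := this
      exact ⟨T, h1, fun _ => ⟨h2, h3⟩⟩
  choose T hTs hTb using hT
  set W := univ.biUnion T with hW
  have hWj : ∀ j, W ∩ V.part j = T j := by
    intro j
    ext x
    simp only [hW, Finset.mem_inter, Finset.mem_biUnion, Finset.mem_univ, true_and]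
    constructor
    · rintro ⟨⟨i, hi⟩, hx⟩
      have h1 := (V.idxH_eq x i).2 (hTs i hi)
      have h2 := (V.idxH_eq x j).2 hx
      rw [← h2, h1]; exact hi
    · intro hx
      exact ⟨⟨j, hx⟩, hTs j hx⟩
  refine ⟨W, ?_⟩
  have hpt : ∀ σ : Fin n → Ω, ∑ j ∈ univ \ J, (ε * (V.part j).card / Fintype.card Ω) *
      (2 * ε * tv (empDist σ (T j)) (empDist σ (V.part j)) - ε ^ 2) ≤ gainH V W σ := by
    intro σ
    unfold gainH
    rw [Finset.sum_comm]
    simp only [hWj]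
    calc _ ≤ ∑ j ∈ univ \ J, ∑ ω, ((T j).card : ℝ) *
          (empDist σ (T j) ω - empDist σ (V.part j) ω) ^ 2 := ?_
      _ ≤ _ := Finset.sum_le_sum_of_subset_of_nonneg (Finset.subset_univ _)
          (fun _ _ _ => by positivity)
    apply Finset.sum_le_sum
    intro j hj
    have hj' : j ∉ J := by simpa using hj
    have h1 := (hTb j hj').1
    rw [← Finset.mul_sum]
    have h2 := tv_sq_le (empDist σ (T j)) (empDist σ (V.part j))
    set t := tv (empDist σ (T j)) (empDist σ (V.part j))
    set Q := ∑ ω, (empDist σ (T j) ω - empDist σ (V.part j) ω) ^ 2 with hQ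
    have hQ0 : 0 ≤ Q := by positivity
    have h3 : 2 * ε * t - ε ^ 2 ≤ Fintype.card Ω * Q := by nlinarith [sq_nonneg (t - ε)]
    calc _ ≤ (ε * (V.part j).card / Fintype.card Ω) * (Fintype.card Ω * Q) := by gcongr
      _ = (ε * (V.part j).card) * Q := by field_simp
      _ ≤ _ := by gcongr
  calc ε ^ 4 * n / Fintype.card Ω = (ε * n) * (ε / Fintype.card Ω * ε ^ 2) := by ring
    _ ≤ (∑ j ∈ univ \ J, ((V.part j).card : ℝ)) * (ε / Fintype.card Ω * ε ^ 2) := by gcongr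
    _ = ∑ j ∈ univ \ J, (ε * (V.part j).card / Fintype.card Ω) * (2 * ε * ε - ε ^ 2) := by
        rw [Finset.sum_mul]
        apply Finset.sum_congr rfl
        intro j _
        ring
    _ ≤ ∑ j ∈ univ \ J, (ε * (V.part j).card / Fintype.card Ω) *
          (2 * ε * expec ν (fun σ => tv (empDist σ (T j)) (empDist σ (V.part j))) - ε ^ 2) := by
        apply Finset.sum_le_sum
        intro j hj
        have := (hTb j (by simpa using hj)).2
        gcongr
    _ = ∑ σ, ν σ * ∑ j ∈ univ \ J, (ε * (V.part j).card / Fintype.card Ω) *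
          (2 * ε * tv (empDist σ (T j)) (empDist σ (V.part j)) - ε ^ 2) := by
        simp only [Finset.mul_sum]
        rw [Finset.sum_comm]
        apply Finset.sum_congr rfl
        intro j _
        have h1 : ε ^ 2 = ∑ σ, ν σ * ε ^ 2 := by rw [← Finset.sum_mul, hν.2, one_mul]
        unfold expec
        conv_lhs => rw [h1]
        rw [Finset.mul_sum, ← Finset.sum_sub_distrib, Finset.mul_sum]
        apply Finset.sum_congr rfl
        intro σ _
        ring
    _ ≤ _ := by
        apply Finset.sum_le_sum
        intro σ _
        exact mul_le_mul_of_nonneg_left (hpt σ) (hν.1 σ)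

lemma typeH (ε : ℝ) (M : ℕ) (hM0 : 0 < M) (hM : (Fintype.card Ω : ℝ) < ε * M)
    (hΩ : 0 < Fintype.card Ω)
    (V : FinPartition (Fin n)) :
    ∃ S : FinPartition (Fin n → Ω), S.k ≤ (M + 1) ^ (V.k * Fintype.card Ω) ∧
      (∀ i : Fin S.k, ∀ j : Fin V.k, ∀ σ ∈ S.part i, ∀ σ' ∈ S.part i,
       tv (empDist σ (V.part j)) (empDist σ' (V.part j)) < ε) := by
  have hM1 : (0 : ℝ) < M := by exact_mod_cast hM0
  have hD : (0 : ℝ) < Fintype.card Ω := by exact_mod_cast hΩ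
  have hfl : ∀ (σ : Fin n → Ω) (j : Fin V.k) (ω : Ω), ⌊M * empDist σ (V.part j) ω⌋₊ < M + 1 := by
    intro σ j ω
    rw [Nat.lt_succ_iff]
    apply Nat.floor_le_of_le
    have := empDist_le_one σ (V.part j) ω
    nlinarith
  obtain ⟨S, hk, hS⟩ := exists_ofColoring (X := Fin n → Ω)
    (A := Fin V.k × Ω → Fin (M + 1))
    (fun σ p => ⟨⌊M * empDist σ (V.part p.1) p.2⌋₊, hfl σ p.1 p.2⟩)
  refine ⟨S, by simpa using hk, ?_⟩
  intro i j σ hσ σ' hσ'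
  have h := (hS σ σ').1 (((S.idxH_eq σ i).2 hσ).trans ((S.idxH_eq σ' i).2 hσ').symm)
  have hω : ∀ ω, |empDist σ (V.part j) ω - empDist σ' (V.part j) ω| ≤ 1 / M := by
    intro ω
    have h1 := congrFun h (j, ω)
    simp only [Fin.mk.injEq] at h1
    have p1 : 0 ≤ M * empDist σ (V.part j) ω := mul_nonneg hM1.le (empDist_nonneg _ _ _)
    have p2 : 0 ≤ M * empDist σ' (V.part j) ω := mul_nonneg hM1.le (empDist_nonneg _ _ _)
    have a1 := Nat.floor_le p1
    have a2 := Nat.lt_floor_add_one (M * empDist σ (V.part j) ω)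
    have b1 := Nat.floor_le p2
    have b2 := Nat.lt_floor_add_one (M * empDist σ' (V.part j) ω)
    rw [h1] at a1 a2
    rw [le_div_iff₀ hM1, ← abs_of_pos hM1, ← abs_mul, abs_le]
    constructor <;> nlinarith
  have : tv (empDist σ (V.part j)) (empDist σ' (V.part j)) ≤ (Fintype.card Ω * (1 / M)) / 2 := by
    unfold tv
    gcongr
    calc _ ≤ ∑ ω : Ω, (1 / M : ℝ) := Finset.sum_le_sum (fun ω _ => hω ω)
      _ = _ := by simp
  refine this.trans_lt ?_
  have : (Fintype.card Ω : ℝ) * (1 / M) < ε := by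
    rw [mul_one_div, div_lt_iff₀ hM1]; exact hM
  have : (0 : ℝ) < (Fintype.card Ω : ℝ) * (1 / M) := by positivity
  linarith

lemma condPMF_isPMF (μ : (Fin n → Ω) → ℝ) (hμ : IsPMF μ) (S : Finset (Fin n → Ω))
    (hS : 0 < mass μ S) : IsPMF (condPMF μ S) := by
  constructor
  · intro x
    unfold condPMF
    split_ifs
    · exact div_nonneg (hμ.1 x) hS.le
    · exact le_rfl
  · unfold condPMF
    rw [Finset.sum_ite_mem, Finset.univ_inter, ← Finset.sum_div]
    exact div_self hS.ne'

lemma sum_condPMF (μ : (Fin n → Ω) → ℝ) (S : Finset (Fin n → Ω)) (g : (Fin n → Ω) → ℝ) :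
    ∑ σ, condPMF μ S σ * g σ = (∑ σ ∈ S, μ σ * g σ) / mass μ S := by
  unfold condPMF
  simp only [ite_mul, zero_mul]
  rw [Finset.sum_ite_mem, Finset.univ_inter, Finset.sum_div]
  apply Finset.sum_congr rfl
  intro x _
  ring

lemma sum_partH {X : Type*} [Fintype X] (S : FinPartition X) (g : X → ℝ) :
    ∑ i, ∑ x ∈ S.part i, g x = ∑ x, g x := by
  simp only [S.part_eq]
  exact Finset.sum_fiberwise _ _ _

lemma stepH (ε : ℝ) (hε : 0 < ε) (hε1 : ε ≤ 1) (M : ℕ) (hM0 : 0 < M)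
    (hM : (Fintype.card Ω : ℝ) < ε * M)
    (hΩ : 0 < Fintype.card Ω) (μ : (Fin n → Ω) → ℝ) (hμ : IsPMF μ) (V : FinPartition (Fin n)) :
    (∃ S : FinPartition (Fin n → Ω), S.k ≤ (M + 1) ^ (V.k * Fintype.card Ω) ∧
      homogeneous ε μ V S) ∨
    (∃ V' : FinPartition (Fin n), V'.k ≤ V.k * 2 ^ ((M + 1) ^ (V.k * Fintype.card Ω) + 1) ∧
      V'.Refines V ∧
      ∑ σ, μ σ * resH V' σ ≤ ∑ σ, μ σ * resH V σ - ε ^ 5 * n / Fintype.card Ω) := by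
  classical
  have hD : (0 : ℝ) < Fintype.card Ω := by exact_mod_cast hΩ
  obtain ⟨S, hSk, hS⟩ := typeH ε M hM0 hM hΩ V
  by_cases hom : homogeneous ε μ V S
  · exact Or.inl ⟨S, hSk, hom⟩
  right
  set η : ℝ := ε ^ 4 * n / Fintype.card Ω with hη
  have hη0 : 0 ≤ η := by positivity
  have hδ : ε ^ 5 * n / Fintype.card Ω = ε * η := by rw [hη]; ring
  set I : Finset (Fin S.k) := univ.filter
    (fun i => 0 < mass μ (S.part i) ∧ regularPart ε (condPMF μ (S.part i)) V) with hI
  have hmass : ∀ i, 0 ≤ mass μ (S.part i) := fun i => Finset.sum_nonneg (fun x _ => hμ.1 x)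
  -- witnesses
  have hWi : ∀ i : Fin S.k, ∃ W : Finset (Fin n), i ∉ I →
      η * mass μ (S.part i) ≤ ∑ σ ∈ S.part i, μ σ * gainH V W σ := by
    intro i
    by_cases hi : i ∈ I
    · exact ⟨∅, fun h => absurd hi h⟩
    by_cases h0 : 0 < mass μ (S.part i)
    · have hr : ¬ regularPart ε (condPMF μ (S.part i)) V := by
        intro h; exact hi (by simp [hI, h0, h])
      obtain ⟨W, hW⟩ := witnessH ε hε hΩ _ (condPMF_isPMF μ hμ _ h0) V hr
      refine ⟨W, fun _ => ?_⟩
      rw [sum_condPMF, le_div_iff₀ h0] at hW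
      exact hW
    · refine ⟨∅, fun _ => ?_⟩
      have : mass μ (S.part i) = 0 := le_antisymm (not_lt.1 h0) (hmass i)
      rw [this, mul_zero]
      exact Finset.sum_nonneg (fun σ _ => mul_nonneg (hμ.1 σ) (gainH_nonneg _ _ _))
  choose Wi hWi using hWi
  have hW0 : ∃ W : Finset (Fin n), ¬ regularPart ε μ V → η ≤ ∑ σ, μ σ * gainH V W σ := by
    by_cases h : regularPart ε μ V
    · exact ⟨∅, fun h' => absurd h h'⟩
    · obtain ⟨W, hW⟩ := witnessH ε hε hΩ μ hμ V h
      exact ⟨W, fun _ => hW⟩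
  obtain ⟨W0, hW0⟩ := hW0
  obtain ⟨V', hk, href, hfin⟩ := refineH V
    (fun b : Option (Fin S.k) => b.elim W0 Wi)
  refine ⟨V', ?_, href, ?_⟩
  · refine hk.trans ?_
    rw [Fintype.card_option, Fintype.card_fin]
    gcongr
    norm_num
  have g0 : ∀ σ : Fin n → Ω, resH V' σ + gainH V W0 σ ≤ resH V σ := fun σ =>
    resH_gain V V' W0 σ (fun x y h => ⟨(hfin x y h).1, (hfin x y h).2 none⟩)
  have gi : ∀ i, ∀ σ : Fin n → Ω, resH V' σ + gainH V (Wi i) σ ≤ resH V σ := fun i σ =>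
    resH_gain V V' (Wi i) σ (fun x y h => ⟨(hfin x y h).1, (hfin x y h).2 (some i)⟩)
  rw [hδ]
  by_cases hreg : regularPart ε μ V
  · have hbad : ε ≤ ∑ i ∈ univ \ I, mass μ (S.part i) := by
      by_contra hlt
      push Not at hlt
      refine hom ⟨I, ?_, hlt, hS, ?_, hreg⟩
      · intro i hi; exact (Finset.mem_filter.1 hi).2.1
      · intro i hi; exact (Finset.mem_filter.1 hi).2.2
    have e1 : ∑ i, (∑ σ ∈ S.part i, μ σ * resH V' σ + if i ∈ I then 0 else η * mass μ (S.part i))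
        ≤ ∑ i, ∑ σ ∈ S.part i, μ σ * resH V σ := by
      apply Finset.sum_le_sum
      intro i _
      have e2 : ∑ σ ∈ S.part i, μ σ * resH V' σ + ∑ σ ∈ S.part i, μ σ * gainH V (Wi i) σ
          ≤ ∑ σ ∈ S.part i, μ σ * resH V σ := by
        rw [← Finset.sum_add_distrib]
        apply Finset.sum_le_sum
        intro σ _
        rw [← mul_add]
        exact mul_le_mul_of_nonneg_left (gi i σ) (hμ.1 σ)
      split_ifs with hi
      · have : 0 ≤ ∑ σ ∈ S.part i, μ σ * gainH V (Wi i) σ :=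
          Finset.sum_nonneg (fun σ _ => mul_nonneg (hμ.1 σ) (gainH_nonneg _ _ _))
        linarith
      · linarith [hWi i hi]
    rw [Finset.sum_add_distrib, sum_partH, sum_partH] at e1
    have e3 : ∑ i, (if i ∈ I then 0 else η * mass μ (S.part i))
        = η * ∑ i ∈ univ \ I, mass μ (S.part i) := by
      rw [Finset.mul_sum, Finset.sum_ite]
      simp only [Finset.sum_const_zero, zero_add]
      apply Finset.sum_congr _ (fun _ _ => rfl)
      ext i; simp
    rw [e3] at e1
    nlinarith
  · have e1 : ∑ σ, μ σ * resH V' σ + ∑ σ, μ σ * gainH V W0 σ ≤ ∑ σ, μ σ * resH V σ := by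
      rw [← Finset.sum_add_distrib]
      apply Finset.sum_le_sum
      intro σ _
      rw [← mul_add]
      exact mul_le_mul_of_nonneg_left (g0 σ) (hμ.1 σ)
    have := hW0 hreg
    nlinarith

/-- Number of classes after one refinement. -/
def growH (M D k : ℕ) : ℕ := k * 2 ^ ((M + 1) ^ (k * D) + 1)

lemma iterH (ε : ℝ) (hε : 0 < ε) (hε1 : ε ≤ 1) (M : ℕ) (hM0 : 0 < M)
    (hM : (Fintype.card Ω : ℝ) < ε * M)
    (hΩ : 0 < Fintype.card Ω) (μ : (Fin n → Ω) → ℝ) (hμ : IsPMF μ) (V₀ : FinPartition (Fin n))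
    (k₀ : ℕ) (hk₀ : V₀.k ≤ k₀) (t : ℕ) :
    (∃ s < t, ∃ V : FinPartition (Fin n), ∃ S : FinPartition (Fin n → Ω), V.Refines V₀ ∧
      V.k ≤ (growH M (Fintype.card Ω))^[s] k₀ ∧ S.k ≤ (M + 1) ^ (V.k * Fintype.card Ω) ∧
      homogeneous ε μ V S) ∨
    (∃ V : FinPartition (Fin n), V.Refines V₀ ∧ V.k ≤ (growH M (Fintype.card Ω))^[t] k₀ ∧
      ∑ σ, μ σ * resH V σ ≤ Fintype.card Ω * n - t * (ε ^ 5 * n / Fintype.card Ω)) := by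
  induction t with
  | zero =>
    right
    refine ⟨V₀, fun i => ⟨i, subset_rfl⟩, by simpa using hk₀, ?_⟩
    calc _ ≤ ∑ σ, μ σ * (Fintype.card Ω * n : ℝ) :=
          Finset.sum_le_sum (fun σ _ => mul_le_mul_of_nonneg_left (resH_le V₀ σ) (hμ.1 σ))
      _ = _ := by rw [← Finset.sum_mul, hμ.2]; simp
  | succ t ih =>
    rcases ih with ⟨s, hs, h⟩ | ⟨V, hV, hk, hr⟩
    · exact Or.inl ⟨s, by omega, h⟩
    rcases stepH ε hε hε1 M hM0 hM hΩ μ hμ V with ⟨S, hS, hh⟩ | ⟨V', hk', hV', hr'⟩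
    · exact Or.inl ⟨t, by omega, V, S, hV, hk, hS, hh⟩
    · right
      refine ⟨V', ?_, ?_, ?_⟩
      · intro i
        obtain ⟨j, hj⟩ := hV' i
        obtain ⟨l, hl⟩ := hV j
        exact ⟨l, hj.trans hl⟩
      · rw [Function.iterate_succ_apply']
        refine hk'.trans ?_
        unfold growH at hk ⊢
        gcongr
        · norm_num
        · omega
      · push_cast
        linarith

end

/-- Theorem: decomposition/regularity for measures on the cube.
For every `ε > 0` and finite `Ω` there is `N > 0` such that for every `n > N`, every
probability measure `μ` on `Ω^n` and every partition `V₀` of `[n]` with at most `1/ε`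
classes, there are a refinement `V` of `V₀` and a partition `S` of `Ω^n` with
`#V + #S ≤ N` such that `μ` is `ε`-homogeneous with respect to `(V, S)`. -/
theorem stmt0 (ε : ℝ) (hε : 0 < ε) (Ω : Type) [Fintype Ω] [DecidableEq Ω]
    (hΩ : 2 ≤ Fintype.card Ω) :
    ∃ N : ℕ, 0 < N ∧ ∀ n : ℕ, N < n →
      ∀ μ : (Fin n → Ω) → ℝ, IsPMF μ →
        ∀ V₀ : FinPartition (Fin n), (V₀.k : ℝ) ≤ 1 / ε →
          ∃ V : FinPartition (Fin n), ∃ S : FinPartition (Fin n → Ω),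
            V.Refines V₀ ∧ V.k + S.k ≤ N ∧ homogeneous ε μ V S := by
  classical
  have hD0 : 0 < Fintype.card Ω := by omega
  have hD : (0 : ℝ) < Fintype.card Ω := by exact_mod_cast hD0
  obtain ⟨M, hM⟩ := exists_nat_gt ((Fintype.card Ω : ℝ) / ε)
  rw [div_lt_iff₀ hε, mul_comm] at hM
  have hM0 : 0 < M := by
    rcases Nat.eq_zero_or_pos M with h | h
    · subst h; simp at hM; linarith
    · exact h
  obtain ⟨T, hT⟩ := exists_nat_gt ((Fintype.card Ω : ℝ) / (ε ^ 5 / Fintype.card Ω))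
  rw [div_lt_iff₀ (by positivity)] at hT
  set K : ℕ → ℕ := fun s => (growH M (Fintype.card Ω))^[s] ⌊1 / ε⌋₊ with hK
  refine ⟨∑ s ∈ Finset.range T, (K s + (M + 1) ^ (K s * Fintype.card Ω)) + 1, by omega, ?_⟩
  intro n hn μ hμ V₀ hV₀
  have hn0 : 0 < n := by omega
  have hn0' : (0 : ℝ) < n := by exact_mod_cast hn0
  have hε1 : ε ≤ 1 := by
    have h1 : 1 ≤ V₀.k := by
      have := (V₀.idxH ⟨0, hn0⟩).pos
      omega
    have h2 : (1 : ℝ) ≤ 1 / ε := le_trans (by exact_mod_cast h1) hV₀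
    rwa [le_div_iff₀ hε, one_mul] at h2
  rcases iterH ε hε hε1 M hM0 hM hD0 μ hμ V₀ ⌊1 / ε⌋₊ (Nat.le_floor hV₀) T with
    ⟨s, hs, V, S, hVr, hVk, hSk, hh⟩ | ⟨V, _, _, hr⟩
  · refine ⟨V, S, hVr, ?_, hh⟩
    have h1 : K s + (M + 1) ^ (K s * Fintype.card Ω) ≤
        ∑ s ∈ Finset.range T, (K s + (M + 1) ^ (K s * Fintype.card Ω)) :=
      Finset.single_le_sum (f := fun s => K s + (M + 1) ^ (K s * Fintype.card Ω))
        (fun _ _ => Nat.zero_le _) (Finset.mem_range.2 hs)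
    have h2 : (M + 1) ^ (V.k * Fintype.card Ω) ≤ (M + 1) ^ (K s * Fintype.card Ω) := by
      apply Nat.pow_le_pow_right (by omega)
      exact Nat.mul_le_mul_right _ hVk
    have h3 : V.k ≤ K s := hVk
    omega
  · exfalso
    have h0 : 0 ≤ ∑ σ, μ σ * resH V σ :=
      Finset.sum_nonneg (fun σ _ => mul_nonneg (hμ.1 σ) (resH_nonneg V σ))
    have h1 := mul_lt_mul_of_pos_right hT hn0'
    have h2 : (T : ℝ) * (ε ^ 5 / Fintype.card Ω) * n = T * (ε ^ 5 * n / Fintype.card Ω) := by ring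
    linarith


end
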